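/- arXiv:1911.03374 — 3 statements merged into one kernel-verified Lean document; each statement's English description precedes it below -/
import Mathlib

section
/- Let K be Lévy's covariance kernel on the circle and for t ∈ [0,1) write t' for the antipodal point (t + 1/2) mod 1. Then for all s, t ∈ [0,1), K(t,t) + K(t',t') + K(s,s) + K(s',s') + 2K(t,t') + 2K(s,s') − 2K(t,s) − 2K(t,s') − 2K(t',s) − 2K(t',s') = 0. (Equivalently, for a centered Gaussian process B with covariance K one has Var(B(t) + B(t') − B(s) − B(s')) = 0, so B(t) + B(t') = B(s) + B(s') almost surely: Lévy's equation (8).) -/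
/-- The circular distance on the unit circle identified with `[0,1)`. -/
noncomputable def circDist (s t : ℝ) : ℝ := min |s - t| (1 - |s - t|)

/-- Lévy's covariance kernel on the circle with base point `0`. -/
noncomputable def levyK (s t : ℝ) : ℝ :=
  (circDist 0 s + circDist 0 t - circDist s t) / 2

/-- The antipodal point of `t ∈ [0,1)`: `(t + 1/2) mod 1`. -/
noncomputable def antipode (t : ℝ) : ℝ := Int.fract (t + 1/2)

theorem circDist_self (s : ℝ) : circDist s s = 0 := by
  simp [circDist]

theorem antipode_mem_Ico (t : ℝ) : antipode t ∈ Set.Ico (0 : ℝ) 1 :=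
  ⟨Int.fract_nonneg _, Int.fract_lt_one _⟩

theorem antipode_eq_ite {t : ℝ} (ht : t ∈ Set.Ico (0 : ℝ) 1) :
    antipode t = if t < 1 / 2 then t + 1 / 2 else t - 1 / 2 := by
  obtain ⟨h0, h1⟩ := ht
  unfold antipode
  split_ifs with h
  · exact Int.fract_eq_self.2 ⟨by linarith, by linarith⟩
  · exact Int.fract_eq_iff.2 ⟨by linarith, by linarith, 1, by push_cast; ring⟩

theorem circDist_add_circDist_antipode {s t : ℝ} (hs : s ∈ Set.Ico (0 : ℝ) 1)
    (ht : t ∈ Set.Ico (0 : ℝ) 1) : circDist s t + circDist s (antipode t) = 1 / 2 := by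
  rw [antipode_eq_ite ht]
  obtain ⟨hs0, hs1⟩ := hs
  obtain ⟨ht0, ht1⟩ := ht
  unfold circDist
  grind

/-- Lévy's equation (8): `Var(B(t) + B(t') − B(s) − B(s')) = 0` for a centered
Gaussian process `B` with covariance `levyK`, expressed purely in terms of the
kernel. -/
theorem levy_equation_eight :
    ∀ s t : ℝ, s ∈ Set.Ico (0 : ℝ) 1 → t ∈ Set.Ico (0 : ℝ) 1 →
      levyK t t + levyK (antipode t) (antipode t)
        + levyK s s + levyK (antipode s) (antipode s)
        + 2 * levyK t (antipode t) + 2 * levyK s (antipode s)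
        - 2 * levyK t s - 2 * levyK t (antipode s)
        - 2 * levyK (antipode t) s - 2 * levyK (antipode t) (antipode s) = 0 := by
  intro s t hs ht
  have h0 : (0 : ℝ) ∈ Set.Ico (0 : ℝ) 1 := by simp
  have ht' := antipode_mem_Ico t
  have h0s := circDist_add_circDist_antipode h0 hs
  have h0t := circDist_add_circDist_antipode h0 ht
  have hss := circDist_add_circDist_antipode hs hs
  have htt := circDist_add_circDist_antipode ht ht
  have hts := circDist_add_circDist_antipode ht hs
  have ht's := circDist_add_circDist_antipode ht' hs
  simp only [circDist_self] at hss htt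
  simp only [levyK, circDist_self]
  linarith
end

section
/- Let K be Lévy's covariance kernel on the circle. Then for every s ∈ (1/2, 1), K(s,s) + K(1/2,1/2) + K(s−1/2, s−1/2) − 2K(s, 1/2) + 2K(s, s−1/2) − 2K(1/2, s−1/2) = 0. (Equivalently, for a centered Gaussian process B with covariance K and B(0)=0, Var(B(s) − B(1/2) − B(s−1/2)) = 0, i.e. B(s) = B(0) + B(1/2) − B(s−1/2) almost surely: the second half-circle is the mirror image of the first.) -/
theorem circDist_eq_sub_of_le_half {s t : ℝ} (hst : s ≤ t) (h : t - s ≤ 1 / 2) :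
    circDist s t = t - s := by
  rw [circDist, abs_sub_comm, abs_of_nonneg (sub_nonneg.2 hst), min_eq_left (by linarith)]

theorem circDist_eq_one_sub_of_half_le {s t : ℝ} (h : 1 / 2 ≤ t - s) :
    circDist s t = 1 - (t - s) := by
  rw [circDist, abs_sub_comm, abs_of_nonneg (by linarith), min_eq_right (by linarith)]

theorem circDist_comm (s t : ℝ) : circDist s t = circDist t s := by
  rw [circDist, circDist, abs_sub_comm]

/-- For `s ∈ (1/2, 1)`, `Var(B(s) − B(1/2) − B(s − 1/2)) = 0` for a centered
Gaussian process `B` with covariance `levyK` and `B(0) = 0`: the second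
half-circle is the mirror image of the first. -/
theorem levy_mirror_image :
    ∀ s : ℝ, s ∈ Set.Ioo (1/2 : ℝ) 1 →
      levyK s s + levyK (1/2) (1/2) + levyK (s - 1/2) (s - 1/2)
        - 2 * levyK s (1/2) + 2 * levyK s (s - 1/2)
        - 2 * levyK (1/2) (s - 1/2) = 0 := by
  rintro s ⟨hs, hs'⟩
  have zero_s : circDist 0 s = 1 - (s - 0) := circDist_eq_one_sub_of_half_le (by linarith)
  have zero_half : circDist 0 (1 / 2) = 1 / 2 - 0 :=
    circDist_eq_sub_of_le_half (by norm_num) (by norm_num)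
  have zero_shift : circDist 0 (s - 1 / 2) = s - 1 / 2 - 0 :=
    circDist_eq_sub_of_le_half (by linarith) (by linarith)
  have half_s : circDist (1 / 2) s = s - 1 / 2 :=
    circDist_eq_sub_of_le_half (by linarith) (by linarith)
  have shift_s : circDist (s - 1 / 2) s = s - (s - 1 / 2) :=
    circDist_eq_sub_of_le_half (by linarith) (by linarith)
  have shift_half : circDist (s - 1 / 2) (1 / 2) = 1 / 2 - (s - 1 / 2) :=
    circDist_eq_sub_of_le_half (by linarith) (by linarith)
  simp only [levyK, circDist_self, circDist_comm s, circDist_comm (1 / 2) (s - 1 / 2),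
    zero_s, zero_half, zero_shift, half_s, shift_s, shift_half]
  ring
end

section
/- For all s, t ∈ [0, 1/2], the series over odd integers ∑_{k ∈ ℤ, k odd} (e^{2πikt} − 1)(e^{−2πiks} − 1) / k² converges (absolutely) and equals 2π² · min(s,t). (Equivalently, the functions η_t(u) = (1/(√2 π)) ∑_{k odd} ((e^{2πikt} − 1)/|k|) e^{2πiku} lie in L²(S) and satisfy ⟨η_t, η_s⟩_{L²} = min(s,t), so the generalized random process η_t(x) on the white noise space shares the covariance of Lévy's Brownian motion on the half-circle.) -/
open Real

theorem Complex.exp_two_pi_I_mul_odd_mul_add_half {k : ℤ} (hk : Odd k) (x : ℂ) :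
    Complex.exp (2 * π * Complex.I * k * (x + 1 / 2)) =
      -Complex.exp (2 * π * Complex.I * k * x) := by
  obtain ⟨m, rfl⟩ := hk
  have h : 2 * π * Complex.I * ((2 * m + 1 : ℤ) : ℂ) * (x + 1 / 2) =
      2 * π * Complex.I * ((2 * m + 1 : ℤ) : ℂ) * x + π * Complex.I
        + m * (2 * π * Complex.I) := by
    push_cast; ring
  rw [h, Complex.exp_add, Complex.exp_int_mul_two_pi_mul_I, Complex.exp_add, Complex.exp_pi_mul_I]
  ring

theorem Complex.exp_two_pi_I_mul_even_mul_add_half {k : ℤ} (hk : Even k) (x : ℂ) :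
    Complex.exp (2 * π * Complex.I * k * (x + 1 / 2)) =
      Complex.exp (2 * π * Complex.I * k * x) := by
  obtain ⟨m, rfl⟩ := hk
  have h : 2 * π * Complex.I * ((m + m : ℤ) : ℂ) * (x + 1 / 2) =
      2 * π * Complex.I * ((m + m : ℤ) : ℂ) * x + m * (2 * π * Complex.I) := by
    push_cast; ring
  rw [h, Complex.exp_add, Complex.exp_int_mul_two_pi_mul_I, mul_one]

theorem hasSum_exp_div_sq {x : ℝ} (hx : x ∈ Set.Icc (0 : ℝ) 1) :
    HasSum (fun k : ℤ => Complex.exp (2 * π * Complex.I * k * x) / (k : ℂ) ^ 2)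
      ((2 * π ^ 2 * (x ^ 2 - x + 1 / 6) : ℝ) : ℂ) := by
  convert! hasSum_one_div_pow_mul_fourier_mul_bernoulliFun le_rfl hx using 1
  · ext k
    rw [fourier_coe_apply, Complex.ofReal_one, div_one]
    ring
  · rw [bernoulliFun_two]
    push_cast
    rw [mul_pow, Complex.I_sq]
    simp only [Nat.factorial]
    push_cast
    ring

theorem hasSum_odd_exp_div_sq_of_nonneg {x : ℝ} (hx : x ∈ Set.Icc (0 : ℝ) (1 / 2)) :
    HasSum (fun k : {k : ℤ // Odd k} =>
      Complex.exp (2 * π * Complex.I * (k : ℤ) * x) / ((k : ℤ) : ℂ) ^ 2)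
      ((π ^ 2 * (1 / 4 - x) : ℝ) : ℂ) := by
  obtain ⟨h0, h1⟩ := hx
  have hdiff := ((hasSum_exp_div_sq (x := x) ⟨h0, by linarith⟩).sub
    (hasSum_exp_div_sq (x := x + 1 / 2) ⟨by linarith, by linarith⟩)).div_const 2
  refine (hasSum_subtype_iff_indicator (s := {k : ℤ | Odd k})
    (f := fun k : ℤ => Complex.exp (2 * π * Complex.I * k * x) / (k : ℂ) ^ 2)).2 ?_
  convert! hdiff using 1
  · ext k
    push_cast
    by_cases hk : Odd k
    · rw [Set.indicator_of_mem (by exact hk), Complex.exp_two_pi_I_mul_odd_mul_add_half hk]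
      ring
    · rw [Set.indicator_of_notMem (by exact hk),
        Complex.exp_two_pi_I_mul_even_mul_add_half (Int.not_odd_iff_even.1 hk)]
      ring
  · push_cast
    ring

theorem hasSum_odd_exp_div_sq {x : ℝ} (hx : |x| ≤ 1 / 2) :
    HasSum (fun k : {k : ℤ // Odd k} =>
      Complex.exp (2 * π * Complex.I * (k : ℤ) * x) / ((k : ℤ) : ℂ) ^ 2)
      ((π ^ 2 * (1 / 4 - |x|) : ℝ) : ℂ) := by
  rcases le_total 0 x with h | h
  · rw [abs_of_nonneg h] at hx ⊢
    exact hasSum_odd_exp_div_sq_of_nonneg ⟨h, hx⟩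
  · rw [abs_of_nonpos h] at hx ⊢
    convert! (hasSum_odd_exp_div_sq_of_nonneg (x := x + 1 / 2)
      ⟨by linarith, by linarith⟩).neg using 1
    · ext k
      push_cast
      rw [Complex.exp_two_pi_I_mul_odd_mul_add_half k.2]
      ring
    · push_cast
      ring

/-- For `s, t ∈ [0, 1/2]`, the series over odd integers
`∑_{k odd} (e^{2πikt} − 1)(e^{−2πiks} − 1)/k²` converges absolutely and equals
`2π² · min(s,t)`.  (Equivalently, `⟨η_t, η_s⟩_{L²(S)} = min(s,t)` for Lévy's
test functions `η_t`.) -/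
theorem odd_fourier_series_min
    (s t : ℝ) (hs : s ∈ Set.Icc (0 : ℝ) (1/2)) (ht : t ∈ Set.Icc (0 : ℝ) (1/2)) :
    Summable (fun k : {k : ℤ // Odd k} =>
      ‖(Complex.exp (2 * π * Complex.I * (k : ℤ) * t) - 1) *
        (Complex.exp (-(2 * π * Complex.I * (k : ℤ) * s)) - 1) /
        ((k : ℤ) : ℂ) ^ 2‖) ∧
    ∑' k : {k : ℤ // Odd k},
      (Complex.exp (2 * π * Complex.I * (k : ℤ) * t) - 1) *
        (Complex.exp (-(2 * π * Complex.I * (k : ℤ) * s)) - 1) /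
        ((k : ℤ) : ℂ) ^ 2
      = ((2 * π ^ 2 * min s t : ℝ) : ℂ) := by
  have hsum : HasSum (fun k : {k : ℤ // Odd k} =>
      (Complex.exp (2 * π * Complex.I * (k : ℤ) * t) - 1) *
        (Complex.exp (-(2 * π * Complex.I * (k : ℤ) * s)) - 1) /
        ((k : ℤ) : ℂ) ^ 2) ((2 * π ^ 2 * min s t : ℝ) : ℂ) := by
    obtain ⟨hs0, hs1⟩ := hs
    obtain ⟨ht0, ht1⟩ := ht
    have hts := hasSum_odd_exp_div_sq (x := t - s) (abs_le.2 ⟨by linarith, by linarith⟩)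
    have ht' := hasSum_odd_exp_div_sq (x := t) (by rwa [abs_of_nonneg ht0])
    have hs' := hasSum_odd_exp_div_sq (x := -s) (by rwa [abs_neg, abs_of_nonneg hs0])
    have h0 := hasSum_odd_exp_div_sq (x := 0) (by norm_num)
    convert! ((hts.sub ht').sub hs').add h0 using 1
    · ext k
      have h : Complex.exp (2 * π * Complex.I * (k : ℤ) * ((t - s : ℝ) : ℂ)) =
          Complex.exp (2 * π * Complex.I * (k : ℤ) * t) *
            Complex.exp (-(2 * π * Complex.I * (k : ℤ) * s)) := by
        rw [← Complex.exp_add]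
        push_cast
        ring_nf
      rw [h]
      push_cast
      rw [mul_neg, mul_zero, Complex.exp_zero]
      ring
    · rw [abs_neg, abs_of_nonneg hs0, abs_of_nonneg ht0, abs_zero,
        inf_eq_half_smul_add_sub_abs_sub' ℝ, smul_eq_mul]
      push_cast
      ring
  exact ⟨hsum.summable.norm, hsum.tsum_eq⟩
end
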